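/- arXiv:2603.20322 — 5 statements merged into one kernel-verified Lean document; each statement's English description precedes it below -/
import Mathlib

section
/- Let L be a natural number, and let μ, μ' : Fin L → ℝ be injective families of pairwise distinct real rates and a, a' : Fin L → ℂ families with a_ℓ ≠ 0 and a'_ℓ ≠ 0 for all ℓ. If ∑_{ℓ} a_ℓ * Real.exp(-μ_ℓ * t) = ∑_{ℓ} a'_ℓ * Real.exp(-μ'_ℓ * t) for every t ≥ 0, then there exists a permutation σ of Fin L with μ' = μ ∘ σ and a' = a ∘ σ (the modal tuples (μ_ℓ, a_ℓ) are uniquely determined by the observable up to permutation). -/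
/-- The geometric sequences `n ↦ exp (-r) ^ n`, for real `r`, are linearly independent over `ℂ`. -/
lemma linearIndependent_exp_neg_pow :
    LinearIndependent ℂ (fun (r : ℝ) (n : Multiplicative ℕ) =>
      (Real.exp (-r) : ℂ) ^ n.toAdd) := by
  have hinj : Function.Injective (fun r : ℝ => powersHom ℂ (Real.exp (-r) : ℂ)) := by
    intro r s hrs
    have h1 := Complex.ofReal_injective ((powersHom ℂ).injective hrs)
    exact neg_injective (Real.exp_injective h1)
  convert (linearIndependent_monoidHom (Multiplicative ℕ) ℂ).comp
    (fun r : ℝ => powersHom ℂ (Real.exp (-r) : ℂ)) hinj using 1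
  · funext r n
    exact (powersHom_apply _ _).symm
  · rfl

/-- Identifiability of exponential sums: two L-term exponential sums with
pairwise distinct rates and nonzero amplitudes which agree for all `t ≥ 0`
have the same modal tuples up to a permutation. -/
theorem exp_sum_identifiability
    (L : ℕ) (μ μ' : Fin L → ℝ)
    (hμ : Function.Injective μ) (hμ' : Function.Injective μ')
    (a a' : Fin L → ℂ)
    (ha : ∀ ℓ, a ℓ ≠ 0) (ha' : ∀ ℓ, a' ℓ ≠ 0)
    (h : ∀ t : ℝ, 0 ≤ t →
      ∑ ℓ : Fin L, a ℓ * (Real.exp (-(μ ℓ) * t) : ℂ) =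
      ∑ ℓ : Fin L, a' ℓ * (Real.exp (-(μ' ℓ) * t) : ℂ)) :
    ∃ σ : Equiv.Perm (Fin L), μ' = μ ∘ σ ∧ a' = a ∘ σ := by
  set F := Finsupp.mapDomain μ (Finsupp.equivFunOnFinite.symm a) with hF
  set G := Finsupp.mapDomain μ' (Finsupp.equivFunOnFinite.symm a') with hG
  have hFG : F = G := by
    apply linearIndependent_exp_neg_pow
    funext n
    have hn := h (n.toAdd : ℝ) (Nat.cast_nonneg _)
    have hexp (r : ℝ) : (Real.exp (-r * (n.toAdd : ℝ)) : ℂ) =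
        (Real.exp (-r) : ℂ) ^ n.toAdd := by
      rw [mul_comm, Real.exp_nat_mul, Complex.ofReal_pow]
    simp only [hexp] at hn
    rw [hF, hG, Finsupp.linearCombination_mapDomain, Finsupp.linearCombination_mapDomain]
    simpa [Finsupp.linearCombination_apply, Finsupp.sum_fintype, Finset.sum_apply] using hn
  have hFμ (ℓ : Fin L) : F (μ ℓ) = a ℓ := Finsupp.mapDomain_apply hμ _ _
  have hGμ' (ℓ : Fin L) : F (μ' ℓ) = a' ℓ := hFG ▸ Finsupp.mapDomain_apply hμ' _ _
  have hmem (ℓ : Fin L) : ∃ k, μ k = μ' ℓ := by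
    by_contra hk
    exact ha' ℓ ((hGμ' ℓ).symm.trans (Finsupp.mapDomain_of_notMem_range _ _ hk))
  choose σ hσ using hmem
  have hσinj : Function.Injective σ := fun i j hij =>
    hμ' (by rw [← hσ i, ← hσ j, hij])
  refine ⟨Equiv.ofBijective σ (Finite.injective_iff_bijective.mp hσinj), ?_, ?_⟩
  · funext ℓ
    exact (hσ ℓ).symm
  · funext ℓ
    change a' ℓ = a (σ ℓ)
    rw [← hGμ', ← hFμ, hσ]
end

section
/- Let F be a field (or take F = ℂ), L a natural number, μ : Fin L → F, and a : Fin L → F. Define the moments m_n = ∑_{ℓ} a_ℓ * μ_ℓ^n for n ∈ ℕ, and let p = ∏_{ℓ} (X - C (μ_ℓ)) be the monic polynomial of degree L with roots μ_ℓ. Then for every n ∈ ℕ, the linear recurrence ∑_{k=0}^{L} (p.coeff k) * m_{n+k} = 0 holds (the moment sequence satisfies the Prony recurrence with characteristic polynomial p). -/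
open Polynomial

/-- The Prony recurrence: the moment sequence `m n = ∑ a_ℓ μ_ℓ^n` satisfies the
linear recurrence whose characteristic polynomial is `p = ∏ (X - μ_ℓ)`. -/
theorem prony_recurrence
    {F : Type*} [Field F] (L : ℕ) (μ : Fin L → F) (a : Fin L → F) :
    ∀ n : ℕ,
      ∑ k ∈ Finset.range (L + 1),
        (∏ ℓ : Fin L, (X - C (μ ℓ))).coeff k * (∑ ℓ : Fin L, a ℓ * μ ℓ ^ (n + k)) = 0 := by
  intro n
  have hdeg : (∏ ℓ : Fin L, (X - C (μ ℓ))).natDegree < L + 1 := by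
    simp [natDegree_prod_of_monic _ _ fun ℓ _ => monic_X_sub_C (μ ℓ)]
  have hroot (ℓ : Fin L) : (∏ i : Fin L, (X - C (μ i))).eval (μ ℓ) = 0 := by
    rw [eval_prod]
    exact Finset.prod_eq_zero (Finset.mem_univ ℓ) (by simp)
  simp_rw [Finset.mul_sum]
  rw [Finset.sum_comm]
  refine Finset.sum_eq_zero fun ℓ _ => ?_
  calc
    _ = a ℓ * μ ℓ ^ n * (∏ i : Fin L, (X - C (μ i))).eval (μ ℓ) := by
      rw [eval_eq_sum_range' hdeg, Finset.mul_sum]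
      exact Finset.sum_congr rfl fun k _ => by ring
    _ = 0 := by rw [hroot, mul_zero]
end

section
/- Let L be a natural number, z : Fin L → ℝ an injective family of pairwise distinct real numbers, and a : Fin L → ℝ with a_ℓ ≠ 0 for all ℓ. Define the Hankel matrix H ∈ Matrix (Fin L) (Fin L) ℝ by H r s = ∑_{ℓ} a_ℓ * z_ℓ^(r + s). Then H = (Matrix.vandermonde z)ᵀ * Matrix.diagonal a * Matrix.vandermonde z, and H is invertible (IsUnit H.det). -/
open Matrix

/-- Hankel factorization and invertibility: the moment Hankel matrix
`H r s = ∑ a_ℓ z_ℓ^{r+s}` factors as `Vᵀ D V` and is invertible when the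
nodes are distinct and the amplitudes nonzero. -/
theorem hankel_factorization_invertible
    (L : ℕ) (z : Fin L → ℝ) (hz : Function.Injective z)
    (a : Fin L → ℝ) (ha : ∀ ℓ, a ℓ ≠ 0)
    (H : Matrix (Fin L) (Fin L) ℝ)
    (hH : ∀ r s : Fin L, H r s = ∑ ℓ : Fin L, a ℓ * z ℓ ^ ((r : ℕ) + (s : ℕ))) :
    H = (Matrix.vandermonde z)ᵀ * Matrix.diagonal a * Matrix.vandermonde z ∧
    IsUnit H.det := by
  have factorization :
      H = (Matrix.vandermonde z)ᵀ * Matrix.diagonal a * Matrix.vandermonde z := by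
    ext r s
    rw [hH, Matrix.mul_apply]
    refine Finset.sum_congr rfl fun ℓ _ => ?_
    rw [Matrix.mul_diagonal, Matrix.transpose_apply, Matrix.vandermonde_apply,
      Matrix.vandermonde_apply]
    ring
  refine ⟨factorization, ?_⟩
  rw [factorization, Matrix.det_mul, Matrix.det_mul, Matrix.det_transpose, Matrix.det_diagonal,
    isUnit_iff_ne_zero]
  have hV : (Matrix.vandermonde z).det ≠ 0 := Matrix.det_vandermonde_ne_zero_iff.mpr hz
  exact mul_ne_zero (mul_ne_zero hV (Finset.prod_ne_zero_iff.mpr fun ℓ _ => ha ℓ)) hV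
end

section
/- Let L be a natural number, and let z, z' : Fin L → ℝ be injective families with 0 < z_ℓ < 1 and 0 < z'_ℓ < 1 for all ℓ, and a, a' : Fin L → ℂ with a_ℓ ≠ 0 and a'_ℓ ≠ 0 for all ℓ. If the 2L samples agree, i.e. ∑_{ℓ} a_ℓ * z_ℓ^n = ∑_{ℓ} a'_ℓ * z'_ℓ^n for every natural number n < 2L, then there exists a permutation σ of Fin L with z' = z ∘ σ and a' = a ∘ σ (finite-window reconstruction: 2L uniform samples uniquely determine the nodes and amplitudes of an L-term exponential sum up to permutation). -/
/-- The first `#s` power moments determine a weight function supported on a finite set `s`. -/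
theorem Finset.eq_zero_of_forall_sum_mul_pow_eq_zero {R : Type*} [CommRing R] [IsDomain R]
    (s : Finset R) (c : R → R) (h : ∀ n < s.card, ∑ x ∈ s, c x * x ^ n = 0) :
    ∀ x ∈ s, c x = 0 := by
  have hv : Function.Injective fun i => (s.equivFin.symm i : R) :=
    Subtype.val_injective.comp s.equivFin.symm.injective
  have h0 := Matrix.eq_zero_of_forall_pow_sum_mul_pow_eq_zero
    (f := fun i => (s.equivFin.symm i : R)) (v := fun i => c (s.equivFin.symm i)) hv fun j => by
      rw [← h j j.2, ← s.sum_coe_sort fun x => c x * x ^ (j : ℕ), ← s.equivFin.symm.sum_comp]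
  intro x hx
  simpa using congrFun h0 (s.equivFin ⟨x, hx⟩)

/-- Grouping the terms of an exponential sum by the value of their node. -/
theorem Finset.sum_sum_ite_mul_pow {ι R : Type*} [Fintype ι] [CommRing R] [DecidableEq R]
    (s : Finset R) (w a : ι → R) (hw : ∀ i, w i ∈ s) (n : ℕ) :
    ∑ x ∈ s, (∑ i, if w i = x then a i else 0) * x ^ n = ∑ i, a i * w i ^ n := by
  simp_rw [Finset.sum_mul]
  rw [Finset.sum_comm]
  refine Finset.sum_congr rfl fun i _ => ?_
  simp [ite_mul, hw i]

/-- Finite-window reconstruction: `2L` uniform samples of an `L`-term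
exponential sum with distinct nodes in `(0,1)` and nonzero amplitudes
determine the nodes and amplitudes up to permutation. -/
theorem finite_window_reconstruction
    (L : ℕ) (z z' : Fin L → ℝ)
    (hz : Function.Injective z) (hz' : Function.Injective z')
    (hz01 : ∀ ℓ, 0 < z ℓ ∧ z ℓ < 1) (hz01' : ∀ ℓ, 0 < z' ℓ ∧ z' ℓ < 1)
    (a a' : Fin L → ℂ)
    (ha : ∀ ℓ, a ℓ ≠ 0) (ha' : ∀ ℓ, a' ℓ ≠ 0)
    (h : ∀ n : ℕ, n < 2 * L →
      ∑ ℓ : Fin L, a ℓ * ((z ℓ : ℂ)) ^ n = ∑ ℓ : Fin L, a' ℓ * ((z' ℓ : ℂ)) ^ n) :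
    ∃ σ : Equiv.Perm (Fin L), z' = z ∘ σ ∧ a' = a ∘ σ := by
  classical
  let w : Fin L → ℂ := fun ℓ => z ℓ
  let w' : Fin L → ℂ := fun ℓ => z' ℓ
  have hw : Function.Injective w := Complex.ofReal_injective.comp hz
  have hw' : Function.Injective w' := Complex.ofReal_injective.comp hz'
  let s : Finset ℂ := Finset.univ.image w ∪ Finset.univ.image w'
  have hws : ∀ i, w i ∈ s := fun i => by simp [s]
  have hws' : ∀ i, w' i ∈ s := fun i => by simp [s]
  have hcard : s.card ≤ 2 * L := by
    refine (Finset.card_union_le _ _).trans ?_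
    simp [Finset.card_image_of_injective _ hw, Finset.card_image_of_injective _ hw', two_mul]
  have hc := s.eq_zero_of_forall_sum_mul_pow_eq_zero
    (fun x => (∑ i, if w i = x then a i else 0) - ∑ i, if w' i = x then a' i else 0)
    fun n hn => by
      simp_rw [sub_mul, Finset.sum_sub_distrib]
      rw [s.sum_sum_ite_mul_pow w a hws, s.sum_sum_ite_mul_pow w' a' hws', sub_eq_zero]
      exact h n (hn.trans_le hcard)
  have key : ∀ ℓ, ∃ m, z' ℓ = z m ∧ a' ℓ = a m := by
    intro ℓ
    have hℓ := hc _ (hws' ℓ)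
    simp only [hw'.eq_iff, Finset.sum_ite_eq', Finset.mem_univ, if_true, sub_eq_zero] at hℓ
    obtain ⟨m, -, hm⟩ := Finset.exists_ne_zero_of_sum_ne_zero (hℓ.trans_ne (ha' ℓ))
    have hmℓ : w m = w' ℓ := by
      by_contra hne
      simp [hne] at hm
    refine ⟨m, Complex.ofReal_injective hmℓ.symm, ?_⟩
    simpa [← hmℓ, hw.eq_iff] using hℓ.symm
  choose σ hσz hσa using key
  have hσ : Function.Injective σ := fun i j hij => hz' (by rw [hσz, hσz, hij])
  exact ⟨Equiv.ofBijective σ (Finite.injective_iff_bijective.mp hσ), funext hσz, funext hσa⟩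
end

section
/- Let L be a natural number, z : Fin L → ℝ an injective family with z_ℓ > 0 for all ℓ, and c, d : Fin L → ℂ. If ∑_{ℓ} (c_ℓ + n * d_ℓ) * z_ℓ^n = 0 for every natural number n < 2L, then c_ℓ = 0 and d_ℓ = 0 for all ℓ (quasi-polynomial independence: the 2L sequences {z_ℓ^n} and {n z_ℓ^n} are linearly independent over n = 0, …, 2L−1; equivalently, the Prony Jacobian at distinct positive nodes with nonzero amplitudes has trivial kernel). -/
open Polynomial in
/-- If the moments of order less than `m` of a confluent functional vanish, so does the functional
on every polynomial of degree less than `m`. -/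
theorem sum_eval_add_derivative_eq_zero {ι K : Type*} [Fintype ι] [Field K]
    {v c d : ι → K} {m : ℕ}
    (h : ∀ n < m, ∑ i, (c i + (n : K) * d i) * v i ^ n = 0)
    {p : K[X]} (hp : p.natDegree < m) :
    ∑ i, (c i * p.eval (v i) + d i * (v i * p.derivative.eval (v i))) = 0 := by
  have key (i : ι) : c i * p.eval (v i) + d i * (v i * p.derivative.eval (v i)) =
      ∑ n ∈ Finset.range m, p.coeff n * ((c i + (n : K) * d i) * v i ^ n) := by
    have hd : v i * p.derivative.eval (v i) =
        ∑ n ∈ Finset.range m, p.coeff n * n * v i ^ n := by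
      conv_lhs => rw [p.as_sum_range' m hp]
      simp only [derivative_sum, eval_finsetSum, Finset.mul_sum, derivative_monomial,
        eval_monomial]
      refine Finset.sum_congr rfl fun n _ => ?_
      cases n with
      | zero => simp
      | succ n => rw [Nat.add_sub_cancel, pow_succ]; ring
    rw [hd, eval_eq_sum_range' hp, Finset.mul_sum, Finset.mul_sum, ← Finset.sum_add_distrib]
    exact Finset.sum_congr rfl fun n _ => by ring
  simp_rw [key]
  rw [Finset.sum_comm]
  refine Finset.sum_eq_zero fun n hn => ?_
  rw [← Finset.mul_sum, h n (Finset.mem_range.1 hn), mul_zero]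

open Polynomial in
/-- The sequences `v i ^ n` and `n * v i ^ n`, `n < 2 * card ι`, at distinct nonzero nodes of a
field are linearly independent. -/
theorem confluent_vandermonde_independence {ι K : Type*} [Fintype ι] [Field K]
    {v c d : ι → K} (hv : Function.Injective v) (hv0 : ∀ i, v i ≠ 0)
    (h : ∀ n < 2 * Fintype.card ι, ∑ i, (c i + (n : K) * d i) * v i ^ n = 0) (k : ι) :
    c k = 0 ∧ d k = 0 := by
  classical
  let M : K[X] := ∏ j ∈ Finset.univ.erase k, (X - C (v j))
  have hM (i : ι) (hi : i ≠ k) : M.eval (v i) = 0 := by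
    rw [eval_prod]
    exact Finset.prod_eq_zero (Finset.mem_erase.2 ⟨hi, Finset.mem_univ i⟩) (by simp)
  have hMk : M.eval (v k) ≠ 0 := by
    rw [eval_prod, Finset.prod_ne_zero_iff]
    intro j hj
    simpa [sub_eq_zero] using fun e => (Finset.ne_of_mem_erase hj) (hv e).symm
  have hMdeg : M.natDegree + 1 = Fintype.card ι := by
    rw [natDegree_finsetProd_X_sub_C_eq_card, Finset.card_erase_add_one (Finset.mem_univ k),
      Finset.card_univ]
  have test (q : K[X]) (hq : q.natDegree ≤ 1) :
      c k * (M ^ 2 * q).eval (v k) + d k * (v k * (M ^ 2 * q).derivative.eval (v k)) = 0 := by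
    have hdeg : (M ^ 2 * q).natDegree < 2 * Fintype.card ι := by
      have h₁ := natDegree_mul_le (p := M ^ 2) (q := q)
      have h₂ := natDegree_pow_le (p := M) (n := 2)
      lia
    have hsum := sum_eval_add_derivative_eq_zero h hdeg
    rwa [Finset.sum_eq_single_of_mem k (Finset.mem_univ k)] at hsum
    intro i _ hi
    simp [derivative_mul, derivative_pow, hM i hi]
  have hdk : d k = 0 := by
    have := test (X - C (v k)) (natDegree_X_sub_C_le _)
    simpa [derivative_mul, hMk, hv0 k] using this
  refine ⟨?_, hdk⟩
  have := test 1 (by simp)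
  simpa [hdk, hMk] using this

/-- Quasi-polynomial independence: the `2L` sequences `z_ℓ^n` and `n z_ℓ^n`
at pairwise distinct positive nodes are linearly independent over
`n = 0, …, 2L - 1`. -/
theorem quasi_polynomial_independence
    (L : ℕ) (z : Fin L → ℝ) (hz : Function.Injective z) (hzpos : ∀ ℓ, 0 < z ℓ)
    (c d : Fin L → ℂ)
    (h : ∀ n : ℕ, n < 2 * L →
      ∑ ℓ : Fin L, (c ℓ + (n : ℂ) * d ℓ) * ((z ℓ : ℂ)) ^ n = 0) :
    ∀ ℓ, c ℓ = 0 ∧ d ℓ = 0 := by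
  exact confluent_vandermonde_independence (v := fun ℓ => (z ℓ : ℂ))
    (Complex.ofReal_injective.comp hz) (fun ℓ => Complex.ofReal_ne_zero.2 (hzpos ℓ).ne')
    (by simpa using h)
end
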